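/- arXiv:2509.05789 — 5 statements merged into one kernel-verified Lean document; each statement's English description precedes it below -/
import Mathlib

section
/- Let J, R, σ₀, Λ ∈ ℂ with J ≠ 0, R ≠ 0, and σ₀J² − 2JR + Λ = 0. Define Q := 3J/R − Λ/R², F² := −4R², and P := −1/J. Then: (i) QF² − 4Λ = −12JR, which is nonzero; (ii) σ₀ = 6F²(QF² + 2Λ)/(QF² − 4Λ)²; (iii) P = 12R/(QF² − 4Λ); and (iv) σ₀ = −(1/6)P²(QF² + 2Λ). -/
/-- **Alternate expressions for `σ₀` and `P` in terms of `Q` and `F²`.**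
Let `J, R, σ₀, Λ ∈ ℂ` with `J ≠ 0`, `R ≠ 0` and `σ₀J² − 2JR + Λ = 0`, and set
`Q = 3J/R − Λ/R²`, `F² = −4R²`, `P = −1/J`.  Then `QF² − 4Λ = −12JR ≠ 0`,
`σ₀ = 6F²(QF² + 2Λ)/(QF² − 4Λ)²`, `P = 12R/(QF² − 4Λ)`, and
`σ₀ = −(1/6)P²(QF² + 2Λ)`. -/
theorem sigma0_P_in_terms_of_Q_F2
    (J R σ₀ Λ : ℂ) (hJ : J ≠ 0) (hR : R ≠ 0)
    (hquad : σ₀ * J ^ 2 - 2 * J * R + Λ = 0)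
    (Q F2 P : ℂ)
    (hQ : Q = 3 * J / R - Λ / R ^ 2)
    (hF2 : F2 = -4 * R ^ 2)
    (hP : P = -1 / J) :
    (Q * F2 - 4 * Λ = -12 * J * R ∧ Q * F2 - 4 * Λ ≠ 0)
    ∧ σ₀ = 6 * F2 * (Q * F2 + 2 * Λ) / (Q * F2 - 4 * Λ) ^ 2
    ∧ P = 12 * R / (Q * F2 - 4 * Λ)
    ∧ σ₀ = -(1 / 6) * P ^ 2 * (Q * F2 + 2 * Λ) := by
  have h1 : Q * F2 - 4 * Λ = -12 * J * R := by
    rw [hQ, hF2]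
    field_simp
    ring
  have h2 : Q * F2 + 2 * Λ = -6 * (σ₀ * J ^ 2) := by
    linear_combination h1 + 6 * hquad
  have h3 : -12 * J * R ≠ 0 := mul_ne_zero (mul_ne_zero (by norm_num) hJ) hR
  rw [h1, h2, hF2, hP]
  refine ⟨⟨rfl, h3⟩, ?_, ?_, ?_⟩
  · rw [eq_div_iff (pow_ne_zero 2 h3)]
    ring
  · rw [div_eq_div_iff hJ h3]
    ring
  · field_simp
end

section
/- Let b, c, k, Λ, y, z ∈ ℝ with b > 0, Λ > 0, and y > 0, and set P := y + iz ∈ ℂ and Δ(s) := k − bs + cs² − (Λ/3)s⁴. Assume Δ(y) = 0, Δ′(y) > 0, and c − by/(y²+z²) − (Λ/3)(y² − z²) ≤ 0. Then P³ ≠ −3b/(4Λ); equivalently, setting R := b/(2P²) − (Λ/3)P, σ₀ := −b/P − (Λ/3)P², J := −1/P, one has R − Jσ₀ ≠ 0. -/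
/-- **Nonvanishing of `R − Jσ₀` on the bifurcate sphere.**
Let `b > 0`, `Λ > 0`, `y > 0`, `P = y + iz`, and `Δ(s) = k − bs + cs² − (Λ/3)s⁴`.
If `Δ(y) = 0`, `Δ′(y) > 0`, and `c − by/(y²+z²) − (Λ/3)(y² − z²) ≤ 0`, then
`P³ ≠ −3b/(4Λ)`; equivalently, with `R = b/(2P²) − (Λ/3)P`,
`σ₀ = −b/P − (Λ/3)P²`, `J = −1/P`, one has `R − Jσ₀ ≠ 0`. -/
theorem R_sub_J_sigma0_ne_zero_on_S0
    (b c k Λ y z : ℝ) (hb : 0 < b) (hΛ : 0 < Λ) (hy : 0 < y)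
    (P : ℂ) (hP : P = (y : ℂ) + (z : ℂ) * Complex.I)
    (Δ : ℝ → ℝ) (hΔdef : ∀ s : ℝ, Δ s = k - b * s + c * s ^ 2 - (Λ / 3) * s ^ 4)
    (hΔy : Δ y = 0) (hΔ' : 0 < deriv Δ y)
    (hT : c - b * y / (y ^ 2 + z ^ 2) - (Λ / 3) * (y ^ 2 - z ^ 2) ≤ 0)
    (R σ₀ J : ℂ)
    (hR : R = (b : ℂ) / (2 * P ^ 2) - ((Λ : ℂ) / 3) * P)
    (hσ₀ : σ₀ = -(b : ℂ) / P - ((Λ : ℂ) / 3) * P ^ 2)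
    (hJ : J = -1 / P) :
    P ^ 3 ≠ -3 * (b : ℂ) / (4 * (Λ : ℂ)) ∧ R - J * σ₀ ≠ 0 := by
  have hd : deriv Δ y = -b + 2 * c * y - (Λ / 3) * (4 * y ^ 3) := by
    have hfun : Δ = fun s => k - b * s + c * s ^ 2 - (Λ / 3) * s ^ 4 := funext hΔdef
    rw [hfun]
    have h := ((((hasDerivAt_id y).const_mul b).const_sub k).add
      ((hasDerivAt_pow 2 y).const_mul c)).sub ((hasDerivAt_pow 4 y).const_mul (Λ / 3))
    refine (HasDerivAt.deriv (h.congr_deriv ?_))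
    norm_num
    ring
  rw [hd] at hΔ'
  have hP0 : P ≠ 0 := by
    intro h
    have := congrArg Complex.re (hP.symm.trans h)
    simp at this
    exact hy.ne' this
  have hΛc : (Λ : ℂ) ≠ 0 := by exact_mod_cast hΛ.ne'
  have key : 4 * (Λ : ℂ) * P ^ 3 + 3 * (b : ℂ) ≠ 0 := by
    intro h
    have hexp : 4 * (Λ : ℂ) * P ^ 3 + 3 * (b : ℂ)
        = ((4 * Λ * (y ^ 3 - 3 * y * z ^ 2) + 3 * b : ℝ) : ℂ)
          + ((4 * Λ * (3 * y ^ 2 * z - z ^ 3) : ℝ) : ℂ) * Complex.I := by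
      rw [hP]
      push_cast
      linear_combination (4 * (Λ : ℂ) * (3 * y * z ^ 2 + z ^ 3 * Complex.I)) * Complex.I_sq
    rw [hexp] at h
    have hre := congrArg Complex.re h
    have him := congrArg Complex.im h
    simp only [Complex.add_re, Complex.add_im, Complex.re_ofReal_mul, Complex.im_ofReal_mul,
      Complex.ofReal_re, Complex.ofReal_im, Complex.I_re, Complex.I_im, Complex.zero_re,
      Complex.zero_im, mul_zero, mul_one, add_zero, zero_add] at hre him
    have hy3 : 0 < Λ * y ^ 3 := by positivity
    have him' : z * (3 * y ^ 2 - z ^ 2) = 0 := by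
      rcases mul_eq_zero.mp him with h1 | h1
      · linarith
      · linarith
    rcases mul_eq_zero.mp him' with hz | hz
    · subst hz
      nlinarith
    · have hz2 : z ^ 2 = 3 * y ^ 2 := by linarith
      rw [hz2] at hT
      have hq : b * y / (y ^ 2 + 3 * y ^ 2) = b / (4 * y) := by
        field_simp
        ring
      rw [hq] at hT
      have h2 := mul_le_mul_of_nonneg_right hT (by positivity : 0 ≤ 2 * y)
      have h3 : b / (4 * y) * (2 * y) = b / 2 := by
        field_simp
        ring
      nlinarith
  constructor
  · intro h
    apply key
    rw [h]
    field_simp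
    ring
  · intro h
    apply key
    have h4 : R - J * σ₀ = -(4 * (Λ : ℂ) * P ^ 3 + 3 * (b : ℂ)) / (6 * P ^ 2) := by
      rw [hR, hσ₀, hJ]
      field_simp
      ring
    rw [h4, div_eq_zero_iff] at h
    rcases h with h | h
    · exact neg_eq_zero.mp h
    · exact absurd h (by simp [hP0])
end

section
/- Let η be the standard Minkowski bilinear form on ℝ⁴ and let K ∈ ℝ⁴ be timelike, i.e. η(K,K) < 0. Then there exist real constants μ > 0 and c > 0 such that for every X ∈ ℝ⁴: η(K,X)² + μ·η(X,X) ≥ c·‖X‖². -/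
/-- The standard Minkowski bilinear form on `ℝ⁴`:
`η(X,Y) = −X₀Y₀ + X₁Y₁ + X₂Y₂ + X₃Y₃`. -/
def minkowski (X Y : Fin 4 → ℝ) : ℝ :=
  -(X 0 * Y 0) + X 1 * Y 1 + X 2 * Y 2 + X 3 * Y 3

/-- **Coercivity at a point where `K` is timelike.**
If `η(K,K) < 0`, then there exist `μ > 0` and `c > 0` such that for every `X ∈ ℝ⁴`,
`η(K,X)² + μ·η(X,X) ≥ c·‖X‖²` (with `‖X‖` the Euclidean norm, so `‖X‖² = ∑ᵢ Xᵢ²`). -/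
theorem timelike_coercivity (K : Fin 4 → ℝ) (hK : minkowski K K < 0) :
    ∃ μ : ℝ, 0 < μ ∧ ∃ c : ℝ, 0 < c ∧
      ∀ X : Fin 4 → ℝ,
        c * (∑ i, X i ^ 2) ≤ (minkowski K X) ^ 2 + μ * minkowski X X := by
  obtain ⟨q, hq⟩ : ∃ q, q = K 1 ^ 2 + K 2 ^ 2 + K 3 ^ 2 := ⟨_, rfl⟩
  obtain ⟨p, hp⟩ : ∃ p, p = K 0 ^ 2 := ⟨_, rfl⟩
  have hq0 : 0 ≤ q := by rw [hq]; positivity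
  have hN : q < p := by unfold minkowski at hK; rw [hq, hp]; nlinarith
  have hS : 0 < p + q := by linarith
  obtain ⟨c, hc⟩ : ∃ c, c = (p - q) ^ 2 / (4 * (p + q)) := ⟨_, rfl⟩
  have hc0 : 0 < c := by
    rw [hc]
    have : 0 < p - q := by linarith
    positivity
  have hcS : c * (p + q) = (p - q) ^ 2 / 4 := by
    rw [hc]; field_simp
  have hB : 0 < (p + q) / 2 - c := by
    by_contra h
    nlinarith [mul_nonneg hq0 (hq0.trans hN.le)]
  refine ⟨(p - q) / 2, by linarith, c, hc0, fun X => ?_⟩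
  obtain ⟨s, hs⟩ : ∃ s, s = K 1 * X 1 + K 2 * X 2 + K 3 * X 3 := ⟨_, rfl⟩
  obtain ⟨W, hW⟩ : ∃ W, W = X 1 ^ 2 + X 2 ^ 2 + X 3 ^ 2 := ⟨_, rfl⟩
  have hW0 : 0 ≤ W := by rw [hW]; positivity
  have hCS : s ^ 2 ≤ q * W := by
    rw [hs, hq, hW]
    nlinarith [sq_nonneg (K 1 * X 2 - K 2 * X 1), sq_nonneg (K 1 * X 3 - K 3 * X 1),
      sq_nonneg (K 2 * X 3 - K 3 * X 2)]
  have h1 : minkowski K X = s - K 0 * X 0 := by rw [hs, minkowski]; ring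
  have h2 : minkowski X X = W - X 0 ^ 2 := by rw [hW, minkowski]; ring
  have h3 : ∑ i, X i ^ 2 = X 0 ^ 2 + W := by rw [hW, Fin.sum_univ_four]; ring
  rw [h1, h2, h3, ← sub_nonneg]
  refine nonneg_of_mul_nonneg_right ?_ hB
  have key : ((p + q) / 2 - c) *
      ((s - K 0 * X 0) ^ 2 + (p - q) / 2 * (W - X 0 ^ 2) - c * (X 0 ^ 2 + W)) =
      (((p + q) / 2 - c) * X 0 - K 0 * s) ^ 2 + ((p - q) / 2 + c) * (q * W - s ^ 2)
        + W * c ^ 2 := by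
    linear_combination (-W) * hcS + (s ^ 2 - ((p + q) / 2 - c) * X 0 ^ 2) * hp
  rw [key]
  have h4 : 0 ≤ q * W - s ^ 2 := by linarith
  have h5 : 0 ≤ (p - q) / 2 + c := by linarith
  positivity
end

section
/- Let A ≥ 1 and c > 0. There exist ε₀ ∈ (0,1) and a constant C₀ ≥ 1, both depending only on A and c, with the following property. Let ε ∈ (0, ε₀); let V be a smooth vector field on B_{ε^{10}} ⊂ ℝ⁴ with sup(|V| + |∂V|) ≤ A; let h : B_{ε^{10}} → (0, ∞) be smooth with h(0) = ε, sup_{B_{ε^{10}}} (ε|D¹h| + ε²|D²h|) ≤ 1, and |V(h)(0)| ≥ c; let e : B_{ε^{10}} → ℝ be smooth with sup_{B_{ε^{10}}} |D^j e| ≤ ε^{10} for j = 0,1,2,3; and set f := log(h + e). Then there is a constant C(ε) such that for every λ ≥ C(ε) and every φ ∈ C_c^∞(B_{ε^{10}}): ‖e^{−λf} φ‖_{L²} ≤ C₀ · λ^{−1} · ‖e^{−λf} V(φ)‖_{L²}. -/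
open MeasureTheory Metric

noncomputable section

/-- `ℝ⁴` with the Euclidean norm. -/
abbrev E4 := EuclideanSpace ℝ (Fin 4)


/-- A function smooth on an open set and vanishing off a closed subset is smooth. -/
lemma contDiff_glue {F : Type*} [NormedAddCommGroup F] [NormedSpace ℝ F]
    {U K : Set E4} (hU : IsOpen U) (hK : IsClosed K) (hKU : K ⊆ U) {u : E4 → F}
    (hu : ContDiffOn ℝ 1 u U) (h0 : ∀ x, x ∉ K → u x = 0) : ContDiff ℝ 1 u := by
  rw [contDiff_iff_contDiffAt]
  intro x
  by_cases hx : x ∈ K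
  · exact hu.contDiffAt (hU.mem_nhds (hKU hx))
  · have : u =ᶠ[nhds x] fun _ => 0 := by
      filter_upwards [hK.isOpen_compl.mem_nhds hx] with y hy using h0 y hy
    exact contDiffAt_const.congr_of_eventuallyEq this

lemma continuous_glue {F : Type*} [NormedAddCommGroup F] [NormedSpace ℝ F]
    {U K : Set E4} (hU : IsOpen U) (hK : IsClosed K) (hKU : K ⊆ U) {u : E4 → F}
    (hu : ContinuousOn u U) (h0 : ∀ x, x ∉ K → u x = 0) : Continuous u := by
  rw [continuous_iff_continuousAt]
  intro x
  by_cases hx : x ∈ K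
  · exact hu.continuousAt (hU.mem_nhds (hKU hx))
  · have : u =ᶠ[nhds x] fun _ => 0 := by
      filter_upwards [hK.isOpen_compl.mem_nhds hx] with y hy using h0 y hy
    exact continuousAt_const.congr this.symm

lemma integrable_fderiv_compact {u : E4 → ℝ} (hu : ContDiff ℝ 1 u) (hc : HasCompactSupport u)
    (v : E4) : Integrable (fun x => fderiv ℝ u x v) volume := by
  apply Continuous.integrable_of_hasCompactSupport
  · exact (hu.continuous_fderiv one_ne_zero).clm_apply continuous_const
  · exact hc.fderiv_apply ℝ v

lemma integral_fderiv_compact {u : E4 → ℝ} (hu : ContDiff ℝ 1 u) (hc : HasCompactSupport u)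
    (v : E4) : ∫ x, fderiv ℝ u x v = 0 := by
  have h := integral_mul_fderiv_eq_neg_fderiv_mul_of_integrable (μ := (volume : Measure E4))
    (f := fun _ => (1 : ℝ)) (g := u) (v := v) (by simp)
    (by simpa using integrable_fderiv_compact hu hc v)
    (by simpa using hu.continuous.integrable_of_hasCompactSupport hc)
    (by simp) (fun x _ => (hu.differentiable one_ne_zero) x)
  simpa using h

/-- Comparison of `L²` norms from comparison of integrals of squares. -/
lemma eLpNorm_le_of_integral_sq {u w : E4 → ℝ} {C : ℝ} (hC : 0 ≤ C)
    (hu : Continuous u) (huc : HasCompactSupport u)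
    (hw : Continuous w) (hwc : HasCompactSupport w)
    (h : ∫ x, u x ^ 2 ≤ C ^ 2 * ∫ x, w x ^ 2) :
    eLpNorm u 2 volume ≤ ENNReal.ofReal C * eLpNorm w 2 volume := by
  have hu2 : MemLp u 2 volume := hu.memLp_of_hasCompactSupport huc
  have hw2 : MemLp w 2 volume := hw.memLp_of_hasCompactSupport hwc
  rw [hu2.eLpNorm_eq_integral_rpow_norm two_ne_zero ENNReal.ofNat_ne_top,
    hw2.eLpNorm_eq_integral_rpow_norm two_ne_zero ENNReal.ofNat_ne_top,
    ← ENNReal.ofReal_mul hC]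
  apply ENNReal.ofReal_le_ofReal
  have e1 : ∀ z : E4 → ℝ, (∫ a, ‖z a‖ ^ (2 : ENNReal).toReal) ^ ((2 : ENNReal).toReal)⁻¹
      = Real.sqrt (∫ a, z a ^ 2) := by
    intro z
    rw [Real.sqrt_eq_rpow]
    simp
  rw [e1, e1]
  calc Real.sqrt (∫ a, u a ^ 2) ≤ Real.sqrt (C ^ 2 * ∫ x, w x ^ 2) := Real.sqrt_le_sqrt h
    _ = C * Real.sqrt (∫ x, w x ^ 2) := by
      rw [Real.sqrt_mul (sq_nonneg C), Real.sqrt_sq hC]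

/-- The standard basis vectors. -/
def bv (i : Fin 4) : E4 := EuclideanSpace.single i 1

lemma bv_sum (v : E4) : v = ∑ i, v i • bv i := by
  ext j
  simp [bv, Finset.sum_apply, Pi.single_apply]

/-- Divergence of a vector field. -/
def divg (V : E4 → E4) (x : E4) : ℝ := ∑ i, (fderiv ℝ V x (bv i)) i

lemma abs_divg_le (V : E4 → E4) (x : E4) : |divg V x| ≤ 4 * ‖fderiv ℝ V x‖ := by
  unfold divg
  refine (Finset.abs_sum_le_sum_abs _ _).trans ?_
  have : ∀ i ∈ (Finset.univ : Finset (Fin 4)),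
      |(fderiv ℝ V x (bv i)) i| ≤ ‖fderiv ℝ V x‖ := by
    intro i _
    have h1 := PiLp.norm_apply_le (fderiv ℝ V x (bv i)) i
    have h2 := (fderiv ℝ V x).le_opNorm (bv i)
    have h3 : ‖bv i‖ = 1 := by simp [bv]
    rw [h3, mul_one] at h2
    exact h1.trans h2
  refine (Finset.sum_le_sum this).trans ?_
  simp

lemma fderiv_prod_comp {ψ : E4 → ℝ} {V : E4 → E4} {x : E4} (hψ : DifferentiableAt ℝ ψ x)
    (hV : DifferentiableAt ℝ V x) (i : Fin 4) :
    fderiv ℝ (fun y => ψ y ^ 2 * V y i) x (bv i)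
      = ψ x ^ 2 * (fderiv ℝ V x (bv i)) i + 2 * ψ x * (V x i * fderiv ℝ ψ x (bv i)) := by
  have h1 : HasFDerivAt (fun y => V y i)
      ((EuclideanSpace.proj i : E4 →L[ℝ] ℝ).comp (fderiv ℝ V x)) x :=
    (EuclideanSpace.proj i : E4 →L[ℝ] ℝ).hasFDerivAt.comp x hV.hasFDerivAt
  have h2 := (hψ.hasFDerivAt.pow 2).mul h1
  have h3 := h2.fderiv
  simp only [Pi.mul_def] at h3
  rw [h3]
  simp
  ring

/-- Main integration by parts inequality. -/
lemma carleman_core {U : Set E4} (hU : IsOpen U) {A c lam s : ℝ} (hc : 0 < c) (hlam : 0 < lam)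
    (hs : s = 1 ∨ s = -1) (hbig : 16 * A ≤ lam * c)
    {V : E4 → E4} (hV : ContDiffOn ℝ 1 V U) (hVA : ∀ x ∈ U, ‖fderiv ℝ V x‖ ≤ A)
    {f : E4 → ℝ} (hf : ContDiffOn ℝ 1 f U) (hVf : ∀ x ∈ U, c / 2 ≤ s * fderiv ℝ f x (V x))
    {φ : E4 → ℝ} (hφ : ContDiff ℝ 1 φ) (hφc : HasCompactSupport φ) (hφU : tsupport φ ⊆ U) :
    eLpNorm (fun x => Real.exp (-(lam * f x)) * φ x) 2 volume
      ≤ ENNReal.ofReal (3 / c * lam⁻¹) *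
        eLpNorm (fun x => Real.exp (-(lam * f x)) * fderiv ℝ φ x (V x)) 2 volume := by
  set ψ : E4 → ℝ := fun x => Real.exp (-(lam * f x)) * φ x with hψdef
  set w : E4 → ℝ := fun x => Real.exp (-(lam * f x)) * fderiv ℝ φ x (V x) with hwdef
  have hKc : IsClosed (tsupport φ) := isClosed_tsupport φ
  have hE : ContDiffOn ℝ 1 (fun x => Real.exp (-(lam * f x))) U :=
    ((contDiffOn_const.mul hf).neg).exp
  have hψ0 : ∀ x, x ∉ tsupport φ → ψ x = 0 := fun x hx => by
    simp [hψdef, image_eq_zero_of_notMem_tsupport hx]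
  have hdφ0 : ∀ x, x ∉ tsupport φ → fderiv ℝ φ x = 0 := fun x hx =>
    fderiv_of_notMem_tsupport ℝ hx
  have hw0 : ∀ x, x ∉ tsupport φ → w x = 0 := fun x hx => by
    simp [hwdef, hdφ0 x hx]
  have hψ : ContDiff ℝ 1 ψ := contDiff_glue hU hKc hφU (hE.mul hφ.contDiffOn) hψ0
  have hw : Continuous w := continuous_glue hU hKc hφU
    (hE.continuousOn.mul ((hφ.continuous_fderiv one_ne_zero).continuousOn.clm_apply
      hV.continuousOn)) hw0
  have hψc : HasCompactSupport ψ := HasCompactSupport.intro hφc hψ0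
  have hwc : HasCompactSupport w := HasCompactSupport.intro hφc hw0
  let F : Fin 4 → E4 → ℝ := fun i y => ψ y ^ 2 * V y i
  have hF0 : ∀ i, ∀ x, x ∉ tsupport φ → F i x = 0 := fun i x hx => by
    simp [F, hψ0 x hx]
  have hF : ∀ i, ContDiff ℝ 1 (F i) := fun i => contDiff_glue hU hKc hφU
    ((hψ.contDiffOn.pow 2).mul
      ((EuclideanSpace.proj i : E4 →L[ℝ] ℝ).contDiff.comp_contDiffOn hV)) (hF0 i)
  have hFc : ∀ i, HasCompactSupport (F i) := fun i => HasCompactSupport.intro hφc (hF0 i)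
  let D : E4 → ℝ := fun x => ∑ i, fderiv ℝ (F i) x (bv i)
  have hDint : Integrable D volume :=
    integrable_finsetSum _ fun i _ => integrable_fderiv_compact (hF i) (hFc i) (bv i)
  have hD0 : ∫ x, D x = 0 := by
    rw [integral_finsetSum _ fun i _ => integrable_fderiv_compact (hF i) (hFc i) (bv i)]
    exact Finset.sum_eq_zero fun i _ => integral_fderiv_compact (hF i) (hFc i) (bv i)
  have hψ2 : Integrable (fun x => ψ x ^ 2) volume :=
    (hψ.continuous.pow 2).integrable_of_hasCompactSupport
      (HasCompactSupport.intro hφc fun x hx => by simp [hψ0 x hx])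
  have hw2 : Integrable (fun x => w x ^ 2) volume :=
    (hw.pow 2).integrable_of_hasCompactSupport
      (HasCompactSupport.intro hφc fun x hx => by simp [hw0 x hx])
  have hlc : 0 < lam * c := mul_pos hlam hc
  have key : ∀ x, ψ x ^ 2 ≤ 8 / (lam * c) ^ 2 * w x ^ 2 - (2 * s / (lam * c)) * D x := by
    intro x
    by_cases hx : x ∈ tsupport φ
    · have hxU := hU.mem_nhds (hφU hx)
      have dV : DifferentiableAt ℝ V x := (hV.contDiffAt hxU).differentiableAt one_ne_zero
      have df : DifferentiableAt ℝ f x := (hf.contDiffAt hxU).differentiableAt one_ne_zero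
      have dφ : DifferentiableAt ℝ φ x := hφ.differentiable one_ne_zero x
      have dψ : DifferentiableAt ℝ ψ x := hψ.differentiable one_ne_zero x
      have hψ' : fderiv ℝ ψ x (V x) = -(lam * fderiv ℝ f x (V x)) * ψ x + w x := by
        have h1 := ((df.hasFDerivAt.const_mul lam).neg.exp.mul dφ.hasFDerivAt).fderiv
        simp only [Pi.mul_def, Pi.neg_def] at h1
        rw [hψdef, h1]
        simp [hwdef]
        ring
      have hDx : D x = ψ x ^ 2 * divg V x + 2 * ψ x * fderiv ℝ ψ x (V x) := by
        have h1 : fderiv ℝ ψ x (V x) = ∑ i, V x i * fderiv ℝ ψ x (bv i) := by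
          conv_lhs => rw [bv_sum (V x)]
          simp [map_sum]
        rw [h1]
        simp only [D, F, divg, fderiv_prod_comp dψ dV, Finset.sum_add_distrib, Finset.mul_sum]
      have hdiv : |divg V x| ≤ 4 * A :=
        (abs_divg_le V x).trans (by linarith [hVA x (hφU hx)])
      have hq := hVf x (hφU hx)
      rw [hDx, hψ']
      generalize divg V x = d at *
      generalize fderiv ℝ f x (V x) = q at *
      generalize ψ x = p at *
      generalize w x = u at *
      have hs2 : s ^ 2 = 1 := by rcases hs with rfl | rfl <;> norm_num
      have hsd : s * d ≤ 4 * A := by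
        rcases hs with rfl | rfl <;> linarith [abs_le.1 hdiv]
      have e1 : 0 ≤ p ^ 2 * (lam * c / 4 - s * d) :=
        mul_nonneg (sq_nonneg _) (by linarith)
      have e2 : 0 ≤ 2 * lam * p ^ 2 * (s * q - c / 2) :=
        mul_nonneg (by positivity) (by linarith)
      have e3 : 0 ≤ (lam * c / 4 * p - s * u) ^ 2 := sq_nonneg _
      have e4 : 2 * s * p * u ≤ lam * c / 4 * p ^ 2 + 4 / (lam * c) * u ^ 2 := by
        have : lam * c / 4 * p ^ 2 + 4 / (lam * c) * u ^ 2 - 2 * s * p * u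
            = 4 / (lam * c) * ((lam * c / 4 * p - s * u) ^ 2 + (1 - s ^ 2) * u ^ 2) := by
          field_simp
          ring
        rw [hs2] at this
        have h5 : 0 ≤ 4 / (lam * c) * ((lam * c / 4 * p - s * u) ^ 2 + (1 - 1) * u ^ 2) := by
          simp only [sub_self, zero_mul, add_zero]; positivity
        linarith
      have e5 : lam * c / 2 * p ^ 2 ≤ 4 / (lam * c) * u ^ 2
          - s * (p ^ 2 * d + 2 * p * (-(lam * q) * p + u)) := by
        nlinarith
      have e6 := mul_le_mul_of_nonneg_left e5 (show 0 ≤ 2 / (lam * c) by positivity)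
      calc p ^ 2 = 2 / (lam * c) * (lam * c / 2 * p ^ 2) := by field_simp
        _ ≤ _ := e6
        _ = _ := by field_simp; ring
    · have hDx : D x = 0 := by
        refine Finset.sum_eq_zero fun i _ => ?_
        have : x ∉ tsupport (F i) := fun h => hx (closure_minimal
          (fun y hy => by by_contra hy'; exact hy (hF0 i y hy')) hKc h)
        rw [fderiv_of_notMem_tsupport ℝ this]; simp
      rw [hψ0 x hx, hw0 x hx, hDx]; simp
  have hI : ∫ x, ψ x ^ 2 ≤ 8 / (lam * c) ^ 2 * ∫ x, w x ^ 2 := by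
    calc ∫ x, ψ x ^ 2 ≤ ∫ x, (8 / (lam * c) ^ 2 * w x ^ 2 - (2 * s / (lam * c)) * D x) :=
          integral_mono hψ2 ((hw2.const_mul _).sub (hDint.const_mul _)) key
      _ = _ := by
          rw [integral_sub (hw2.const_mul _) (hDint.const_mul _), integral_const_mul,
            integral_const_mul, hD0]; simp
  apply eLpNorm_le_of_integral_sq (by positivity) hψ.continuous hψc hw hwc
  refine hI.trans (mul_le_mul_of_nonneg_right ?_ (integral_nonneg fun x => sq_nonneg _))
  have : (3 / c * lam⁻¹) ^ 2 = 9 / (lam * c) ^ 2 := by field_simp; norm_num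
  rw [this]
  gcongr
  norm_num

/-- **Carleman estimate adapted to transport equations.**
Let `A ≥ 1` and `c > 0`.  There exist `ε₀ ∈ (0,1)` and `C₀ ≥ 1`, depending only on `A`
and `c`, with the following property.  For `ε ∈ (0, ε₀)`, a smooth vector field `V` on
`B_{ε^{10}}` with `sup(|V| + |∂V|) ≤ A`, a smooth `h : B_{ε^{10}} → (0,∞)` with
`h(0) = ε`, `sup (ε|D¹h| + ε²|D²h|) ≤ 1` and `|V(h)(0)| ≥ c`, and a negligible
perturbation `e` (`sup |D^j e| ≤ ε^{10}`, `j = 0,…,3`), set `f = log(h+e)`.  Then there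
is `C(ε)` such that for all `λ ≥ C(ε)` and all `φ ∈ C_c^∞(B_{ε^{10}})`:
`‖e^{−λf} φ‖_{L²} ≤ C₀ λ⁻¹ ‖e^{−λf} V(φ)‖_{L²}`. -/
theorem carleman_estimate_transport (A c : ℝ) (hA : 1 ≤ A) (hc : 0 < c) :
    ∃ ε₀ ∈ Set.Ioo (0 : ℝ) 1, ∃ C₀ : ℝ, 1 ≤ C₀ ∧
      ∀ ε ∈ Set.Ioo (0 : ℝ) ε₀,
      ∀ V : E4 → E4, ContDiffOn ℝ (⊤ : ℕ∞) V (ball 0 (ε ^ 10)) →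
        (∀ x ∈ ball (0 : E4) (ε ^ 10), ‖V x‖ + ‖fderiv ℝ V x‖ ≤ A) →
      ∀ h : E4 → ℝ, ContDiffOn ℝ (⊤ : ℕ∞) h (ball 0 (ε ^ 10)) →
        (∀ x ∈ ball (0 : E4) (ε ^ 10), 0 < h x) →
        h 0 = ε →
        (∀ x ∈ ball (0 : E4) (ε ^ 10),
          ε * ‖iteratedFDeriv ℝ 1 h x‖ + ε ^ 2 * ‖iteratedFDeriv ℝ 2 h x‖ ≤ 1) →
        c ≤ |fderiv ℝ h 0 (V 0)| →
      ∀ e : E4 → ℝ, ContDiffOn ℝ (⊤ : ℕ∞) e (ball 0 (ε ^ 10)) →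
        (∀ x ∈ ball (0 : E4) (ε ^ 10), ∀ j ∈ Finset.range 4,
          ‖iteratedFDeriv ℝ j e x‖ ≤ ε ^ 10) →
      ∃ C : ℝ, ∀ lam : ℝ, C ≤ lam →
        ∀ φ : E4 → ℝ, ContDiff ℝ (⊤ : ℕ∞) φ → HasCompactSupport φ →
          tsupport φ ⊆ ball 0 (ε ^ 10) →
          eLpNorm (fun x => Real.exp (-(lam * Real.log (h x + e x))) * φ x) 2 volume
            ≤ ENNReal.ofReal (C₀ * lam⁻¹) *
              eLpNorm (fun x =>
                Real.exp (-(lam * Real.log (h x + e x))) * fderiv ℝ φ x (V x)) 2 volume := by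
  have hA0 : 0 < A := by linarith
  refine ⟨min (1 / 4) (c / (6 * A)), ⟨by positivity, ?_⟩, max 1 (3 / c), le_max_left _ _, ?_⟩
  · exact (min_le_left _ _).trans_lt (by norm_num)
  rintro ε ⟨hε, hε0⟩ V hV hVA h hh hhpos hh0 hhD hc0 e he heD
  have hε4 : ε < 1 / 4 := hε0.trans_le (min_le_left _ _)
  have hεc : ε * (6 * A) < c := by
    rw [← lt_div_iff₀ (by positivity)]
    exact hε0.trans_le (min_le_right _ _)
  set r := ε ^ 10 with hr
  have hr0 : 0 < r := by positivity
  have h0U : (0 : E4) ∈ ball (0 : E4) r := mem_ball_self hr0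
  have hUo : IsOpen (ball (0 : E4) r) := isOpen_ball
  have hpw : ∀ n : ℕ, 1 ≤ n → ε ^ (n + 1) ≤ ε / 4 := by
    intro n hn
    rw [pow_succ]
    have : ε ^ n ≤ ε ^ 1 := pow_le_pow_of_le_one hε.le (by linarith) hn
    nlinarith
  have hcd : ∀ x ∈ ball (0 : E4) r, ContDiffAt ℝ (⊤ : ℕ∞) h x := fun x hx =>
    hh.contDiffAt (hUo.mem_nhds hx)
  have hce : ∀ x ∈ ball (0 : E4) r, ContDiffAt ℝ (⊤ : ℕ∞) e x := fun x hx =>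
    he.contDiffAt (hUo.mem_nhds hx)
  have hdh : ∀ x ∈ ball (0 : E4) r, DifferentiableAt ℝ h x := fun x hx =>
    (hcd x hx).differentiableAt (by simp)
  have hde : ∀ x ∈ ball (0 : E4) r, DifferentiableAt ℝ e x := fun x hx =>
    (hce x hx).differentiableAt (by simp)
  have hdV : ∀ x ∈ ball (0 : E4) r, DifferentiableAt ℝ V x := fun x hx =>
    (hV.contDiffAt (hUo.mem_nhds hx)).differentiableAt (by simp)
  have hddh : ∀ x ∈ ball (0 : E4) r, DifferentiableAt ℝ (fderiv ℝ h) x := fun x hx =>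
    ((hcd x hx).fderiv_right (m := 1)
      (WithTop.coe_le_coe.2 (le_top : (1 + 1 : ℕ∞) ≤ ⊤))).differentiableAt one_ne_zero
  have b1 : ∀ x ∈ ball (0 : E4) r, ‖fderiv ℝ h x‖ ≤ 1 / ε := by
    intro x hx
    have := hhD x hx
    rw [norm_iteratedFDeriv_one] at this
    rw [le_div_iff₀ hε]
    nlinarith [norm_nonneg (iteratedFDeriv ℝ 2 h x), sq_nonneg ε,
      mul_nonneg (sq_nonneg ε) (norm_nonneg (iteratedFDeriv ℝ 2 h x))]
  have b2 : ∀ x ∈ ball (0 : E4) r, ‖fderiv ℝ (fderiv ℝ h) x‖ ≤ 1 / ε ^ 2 := by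
    intro x hx
    have := hhD x hx
    rw [show iteratedFDeriv ℝ 2 h = iteratedFDeriv ℝ (1 + 1) h from rfl,
      ← norm_iteratedFDeriv_fderiv (n := 1), norm_iteratedFDeriv_one (fderiv ℝ h)] at this
    rw [le_div_iff₀ (by positivity)]
    nlinarith [mul_nonneg hε.le (norm_nonneg (iteratedFDeriv ℝ 1 h x))]
  have bV : ∀ x ∈ ball (0 : E4) r, ‖V x‖ ≤ A := fun x hx => by
    linarith [hVA x hx, norm_nonneg (fderiv ℝ V x)]
  have bDV : ∀ x ∈ ball (0 : E4) r, ‖fderiv ℝ V x‖ ≤ A := fun x hx => by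
    linarith [hVA x hx, norm_nonneg (V x)]
  have be : ∀ x ∈ ball (0 : E4) r, |e x| ≤ r := fun x hx => by
    have := heD x hx 0 (by simp)
    rwa [norm_iteratedFDeriv_zero] at this
  have bDe : ∀ x ∈ ball (0 : E4) r, ‖fderiv ℝ e x‖ ≤ r := fun x hx => by
    have := heD x hx 1 (by simp)
    rwa [norm_iteratedFDeriv_one] at this
  have hcv : Convex ℝ (ball (0 : E4) r) := convex_ball 0 r
  have hnx : ∀ x ∈ ball (0 : E4) r, ‖x - 0‖ ≤ r := fun x hx => by
    rw [sub_zero]; exact (mem_ball_zero_iff.1 hx).le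
  have m1 : ∀ x ∈ ball (0 : E4) r, |h x - ε| ≤ ε / 4 := by
    intro x hx
    have h1 := hcv.norm_image_sub_le_of_norm_fderiv_le hdh b1 h0U hx
    rw [hh0] at h1
    calc |h x - ε| ≤ 1 / ε * ‖x - 0‖ := h1
      _ ≤ 1 / ε * r := by gcongr; exact hnx x hx
      _ = ε ^ (8 + 1) := by rw [hr]; field_simp
      _ ≤ ε / 4 := hpw 8 (by norm_num)
  have hr4 : r ≤ ε / 4 := hpw 9 (by norm_num)
  have gpos : ∀ x ∈ ball (0 : E4) r, 0 < h x + e x := fun x hx => by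
    linarith [(abs_le.1 (m1 x hx)).1, (abs_le.1 (be x hx)).1]
  have gle : ∀ x ∈ ball (0 : E4) r, h x + e x ≤ 1 := fun x hx => by
    linarith [(abs_le.1 (m1 x hx)).2, (abs_le.1 (be x hx)).2]
  have m2 : ∀ x ∈ ball (0 : E4) r,
      |fderiv ℝ h x (V x) + fderiv ℝ e x (V x) - fderiv ℝ h 0 (V 0)| ≤ c / 2 := by
    intro x hx
    have h1 := hcv.norm_image_sub_le_of_norm_fderiv_le hddh b2 h0U hx
    have h2 := hcv.norm_image_sub_le_of_norm_fderiv_le hdV bDV h0U hx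
    have k1 : ‖(fderiv ℝ h x - fderiv ℝ h 0) (V x)‖ ≤ A * ε := by
      calc _ ≤ ‖fderiv ℝ h x - fderiv ℝ h 0‖ * ‖V x‖ := ContinuousLinearMap.le_opNorm _ _
        _ ≤ (1 / ε ^ 2 * r) * A := by
            gcongr
            · exact h1.trans (by gcongr; exact hnx x hx)
            · exact bV x hx
        _ = A * ε ^ (7 + 1) := by rw [hr]; field_simp
        _ ≤ A * ε := by exact mul_le_mul_of_nonneg_left ((hpw 7 (by norm_num)).trans (by linarith)) hA0.le
    have k2 : ‖fderiv ℝ h 0 (V x - V 0)‖ ≤ A * ε := by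
      calc _ ≤ ‖fderiv ℝ h 0‖ * ‖V x - V 0‖ := ContinuousLinearMap.le_opNorm _ _
        _ ≤ (1 / ε) * (A * r) := by
            gcongr
            · exact b1 0 h0U
            · exact h2.trans (by gcongr; exact hnx x hx)
        _ = A * ε ^ (8 + 1) := by rw [hr]; field_simp
        _ ≤ A * ε := by exact mul_le_mul_of_nonneg_left ((hpw 8 (by norm_num)).trans (by linarith)) hA0.le
    have k3 : ‖fderiv ℝ e x (V x)‖ ≤ A * ε := by
      calc _ ≤ ‖fderiv ℝ e x‖ * ‖V x‖ := ContinuousLinearMap.le_opNorm _ _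
        _ ≤ r * A := by
            gcongr
            · exact bDe x hx
            · exact bV x hx
        _ ≤ A * ε := by rw [mul_comm]; gcongr; linarith
    simp only [sub_apply, map_sub, Real.norm_eq_abs] at k1 k2 k3
    rw [abs_le] at *
    constructor <;> linarith
  obtain ⟨s, hs, hsc⟩ : ∃ s : ℝ, (s = 1 ∨ s = -1) ∧ c ≤ s * fderiv ℝ h 0 (V 0) := by
    rcases le_abs.1 hc0 with h1 | h1
    · exact ⟨1, Or.inl rfl, by linarith⟩
    · exact ⟨-1, Or.inr rfl, by linarith⟩
  have hVf : ∀ x ∈ ball (0 : E4) r,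
      c / 2 ≤ s * fderiv ℝ (fun y => Real.log (h y + e y)) x (V x) := by
    intro x hx
    have hg := gpos x hx
    have h1 := (((hdh x hx).hasFDerivAt.add (hde x hx).hasFDerivAt).log hg.ne').fderiv
    simp only [Pi.add_def] at h1
    rw [h1]
    have h2 : c / 2 ≤ s * (fderiv ℝ h x (V x) + fderiv ℝ e x (V x)) := by
      have := abs_le.1 (m2 x hx)
      rcases hs with rfl | rfl <;> linarith
    have h3 : 1 ≤ (h x + e x)⁻¹ := (one_le_inv₀ hg).2 (gle x hx)
    simp only [smul_apply, add_apply, smul_eq_mul]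
    nlinarith
  refine ⟨16 * A / c, fun lam hlam φ hφ hφc hφU => ?_⟩
  have hlam0 : 0 < lam := lt_of_lt_of_le (by positivity) hlam
  have hf : ContDiffOn ℝ 1 (fun y => Real.log (h y + e y)) (ball (0 : E4) r) :=
    ((hh.add he).of_le (by exact_mod_cast le_top)).log fun x hx => (gpos x hx).ne'
  refine (carleman_core hUo (A := A) hc hlam0 hs ((div_le_iff₀ hc).1 hlam)
    (hV.of_le (by exact_mod_cast le_top)) bDV hf hVf
    (hφ.of_le (by exact_mod_cast le_top)) hφc hφU).trans ?_
  gcongr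
  exact le_max_right _ _
end
end

section
/- Let b, c, Λ, y, z ∈ ℝ with (y, z) ≠ (0, 0), and set P := y + iz ∈ ℂ, R := b/(2P²) − (Λ/3)P, J := −1/P, and N := Re(c − b/P − (Λ/3)P²). Then Re(2(R − J·N)) = (−b + 2cy − (4Λ/3)y³)/(y² + z²). Equivalently, writing Δ(s) := k − bs + cs² − (Λ/3)s⁴ for any fixed k ∈ ℝ, one has Re(2(R − J·N)) = Δ′(y)/(y² + z²). -/
/-- **The wave-equation coefficient for `y`.**
For real `b, c, Λ, y, z` with `(y,z) ≠ (0,0)`, set `P = y + iz`,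
`R = b/(2P²) − (Λ/3)P`, `J = −1/P` and `N = Re(c − b/P − (Λ/3)P²)`.  Then
`Re(2(R − JN)) = (−b + 2cy − (4Λ/3)y³)/(y² + z²)`; equivalently, for any `k ∈ ℝ`,
`Re(2(R − JN)) = Δ′(y)/(y² + z²)` where `Δ(s) = k − bs + cs² − (Λ/3)s⁴`. -/
theorem wave_equation_coefficient
    (b c Λ y z : ℝ) (hyz : ((y, z) : ℝ × ℝ) ≠ (0, 0))
    (P R J : ℂ) (N : ℝ)
    (hP : P = (y : ℂ) + (z : ℂ) * Complex.I)
    (hR : R = (b : ℂ) / (2 * P ^ 2) - ((Λ : ℂ) / 3) * P)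
    (hJ : J = -1 / P)
    (hN : N = ((c : ℂ) - (b : ℂ) / P - ((Λ : ℂ) / 3) * P ^ 2).re) :
    (2 * (R - J * (N : ℂ))).re = (-b + 2 * c * y - (4 * Λ / 3) * y ^ 3) / (y ^ 2 + z ^ 2)
    ∧ ∀ k : ℝ,
        (2 * (R - J * (N : ℂ))).re
          = deriv (fun s : ℝ => k - b * s + c * s ^ 2 - (Λ / 3) * s ^ 4) y
            / (y ^ 2 + z ^ 2) := by
  have hD : y ^ 2 + z ^ 2 ≠ 0 := by
    intro h
    apply hyz
    have h1 : y = 0 := by nlinarith [sq_nonneg y, sq_nonneg z]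
    have h2 : z = 0 := by nlinarith [sq_nonneg y, sq_nonneg z]
    rw [h1, h2]
  obtain ⟨u, hu⟩ : ∃ u : ℝ, u = y / (y ^ 2 + z ^ 2) := ⟨_, rfl⟩
  obtain ⟨v, hv⟩ : ∃ v : ℝ, v = -z / (y ^ 2 + z ^ 2) := ⟨_, rfl⟩
  have hQ : P⁻¹ = (u : ℂ) + (v : ℂ) * Complex.I := by
    apply inv_eq_of_mul_eq_one_right
    rw [hP]
    apply Complex.ext
    · simp
      rw [hu, hv]
      field_simp
      ring
    · simp
      rw [hu, hv]
      field_simp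
      ring
  have hR' : R = ((b / 2 : ℝ) : ℂ) * (P⁻¹ * P⁻¹) - ((Λ / 3 : ℝ) : ℂ) * P := by
    rw [hR]
    push_cast
    rw [div_eq_mul_inv, mul_inv, ← inv_pow]
    ring
  have hJ' : J = -P⁻¹ := by rw [hJ]; ring
  have hN' : N = c - b * u - Λ / 3 * (y ^ 2 - z ^ 2) := by
    have : (c : ℂ) - (b : ℂ) / P - ((Λ : ℂ) / 3) * P ^ 2
        = (c : ℂ) - (b : ℂ) * P⁻¹ - ((Λ / 3 : ℝ) : ℂ) * (P * P) := by
      push_cast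
      ring
    rw [hN, this, hQ, hP]
    simp only [Complex.sub_re, Complex.mul_re, Complex.add_re, Complex.mul_im, Complex.add_im,
      Complex.ofReal_re, Complex.ofReal_im, Complex.I_re, Complex.I_im]
    ring
  have key : (2 * (R - J * (N : ℂ))).re
      = (-b + 2 * c * y - (4 * Λ / 3) * y ^ 3) / (y ^ 2 + z ^ 2) := by
    have h : (2 * (R - J * (N : ℂ))).re = b * (u ^ 2 - v ^ 2) - 2 * (Λ / 3) * y + 2 * u * N := by
      rw [hR', hJ', hQ, hP]
      simp only [Complex.sub_re, Complex.mul_re, Complex.add_re, Complex.mul_im, Complex.add_im,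
        Complex.neg_re, Complex.neg_im, Complex.sub_im, Complex.re_ofNat, Complex.im_ofNat,
        Complex.ofReal_re, Complex.ofReal_im, Complex.I_re, Complex.I_im]
      ring
    rw [h, hN', hu, hv]
    field_simp
    ring
  refine ⟨key, fun k => ?_⟩
  rw [key]
  congr 1
  have hd : HasDerivAt (fun s : ℝ => k - b * s + c * s ^ 2 - (Λ / 3) * s ^ 4)
      (-b + 2 * c * y - (4 * Λ / 3) * y ^ 3) y := by
    have h1 := ((((hasDerivAt_id' y).const_mul b).const_sub k).add
      ((hasDerivAt_pow 2 y).const_mul c)).sub ((hasDerivAt_pow 4 y).const_mul (Λ / 3))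
    refine h1.congr_deriv ?_
    norm_num
    ring
  exact hd.deriv.symm
end
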